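/- Let σ, τ be weight functions in the class W₀ with associated weight matrices {S^(ℓ) : ℓ > 0} and {T^(ℓ) : ℓ > 0}, and assume σ(t) = o(τ(t)) as t → +∞. (i) If γ̄(τ) < γ(σ) (as elements of [0,+∞]), then for all ℓ, ℓ₁, j, j₁ > 0: γ(ω_{S^(ℓ₁)}) ≤ γ(ω_{S^(ℓ)}⋆̂ω_{T^(j)}) + γ̄(ω_{T^(j₁)}). (ii) If 0 < γ(τ) ≤ γ̄(τ) < γ(σ) ≤ γ̄(σ) < +∞, then for all ℓ, ℓ₁, j, j₁ > 0: γ̄(ω_{S^(ℓ)}⋆̂ω_{T^(j)}) + γ(ω_{T^(j₁)}) ≤ γ̄(ω_{S^(ℓ₁)}). -/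

import Mathlib

open Real Filter Asymptotics Set
open scoped ENNReal Topology

noncomputable section

/-- A weight function: nonnegative, non-decreasing on `[0,∞)`, tending to `+∞`. -/
def IsWeightFct (ω : ℝ → ℝ) : Prop :=
  (∀ t : ℝ, 0 ≤ ω t) ∧ MonotoneOn ω (Ici (0:ℝ)) ∧ Tendsto ω atTop atTop

/-- Condition `(ω₁)`: `ω(2t) = O(ω(t))`. -/
def HasOm1 (ω : ℝ → ℝ) : Prop :=
  ∃ L : ℝ, 1 ≤ L ∧ ∀ t : ℝ, 0 ≤ t → ω (2 * t) ≤ L * (ω t + 1)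

/-- Condition `(ω₆)`. -/
def HasOm6 (ω : ℝ → ℝ) : Prop :=
  ∃ H : ℝ, 1 ≤ H ∧ ∀ t : ℝ, 0 ≤ t → 2 * ω t ≤ ω (H * t) + H

/-- The class `W₀` of (normalized) Braun-Meise-Taylor weight functions. -/
def IsW0 (ω : ℝ → ℝ) : Prop :=
  IsWeightFct ω ∧ ContinuousOn ω (Ici (0:ℝ)) ∧ (∀ t ∈ Icc (0:ℝ) 1, ω t = 0) ∧
    ((fun t : ℝ => Real.log t) =o[atTop] ω) ∧
    ConvexOn ℝ univ (fun y : ℝ => ω (Real.exp y))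

/-- Legendre-Fenchel-Young conjugate `φ*_ω`. -/
def phiStar (ω : ℝ → ℝ) (x : ℝ) : ℝ :=
  sSup {z : ℝ | ∃ y : ℝ, 0 ≤ y ∧ z = x * y - ω (Real.exp y)}

/-- The sequence `W^(ℓ)` of the associated weight matrix of `ω`. -/
def assocSeq (ω : ℝ → ℝ) (ℓ : ℝ) (p : ℕ) : ℝ :=
  Real.exp ((1 / ℓ) * phiStar ω (ℓ * (p : ℝ)))

/-- The weight function `ω_M` associated with a sequence `M`. -/
def omegaSeq (M : ℕ → ℝ) (t : ℝ) : ℝ :=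
  sSup {z : ℝ | ∃ p : ℕ, z = Real.log (t ^ p / M p)}

/-- Property `(P_{ω,γ})`. -/
def gammaProp (ω : ℝ → ℝ) (g : ℝ) : Prop :=
  ∃ K : ℝ, 1 < K ∧
    limsup (fun t : ℝ => ((ω (K ^ g * t) / ω t : ℝ) : EReal)) atTop < (K : EReal)

/-- Property `(P̄_{ω,γ})`. -/
def gammaBarProp (ω : ℝ → ℝ) (g : ℝ) : Prop :=
  ∃ A : ℝ, 1 < A ∧
    (A : EReal) < liminf (fun t : ℝ => ((ω (A ^ g * t) / ω t : ℝ) : EReal)) atTop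

/-- The growth index `γ(ω) ∈ [0,∞]`. -/
def gammaIdx (ω : ℝ → ℝ) : ℝ≥0∞ :=
  ⨆ (g : ℝ) (_ : 0 < g ∧ gammaProp ω g), ENNReal.ofReal g

/-- The growth index `γ̄(ω) ∈ [0,∞]` (`+∞` if no admissible `γ` exists). -/
def gammaBarIdx (ω : ℝ → ℝ) : ℝ≥0∞ :=
  sInf (ENNReal.ofReal '' {g : ℝ | 0 < g ∧ gammaBarProp ω g})

/-- Generalized lower Legendre conjugate `σ ⋆̌ τ`. -/
def lowerConj (σ τ : ℝ → ℝ) (t : ℝ) : ℝ :=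
  sInf {z : ℝ | ∃ s : ℝ, 0 < s ∧ z = σ s + τ (t / s)}

/-- Generalized upper Legendre conjugate `σ ⋆̂ τ`. -/
def upperConj (σ τ : ℝ → ℝ) (t : ℝ) : ℝ :=
  if t = 0 then σ 0 - τ 0 else sSup {z : ℝ | ∃ s : ℝ, 0 ≤ s ∧ z = σ s - τ (s / t)}

/-- `σ ⋆̂ τ` is well-defined, i.e. `σ⋆̂τ(t) < +∞` for every `t`. -/
def UpperConjWD (σ τ : ℝ → ℝ) : Prop :=
  ∀ t : ℝ, 0 < t → BddAbove {z : ℝ | ∃ s : ℝ, 0 ≤ s ∧ z = σ s - τ (s / t)}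

/-- Lower Legendre envelope `h_⋆`. -/
def lowerEnv (h : ℝ → ℝ) (t : ℝ) : ℝ :=
  sInf {z : ℝ | ∃ u : ℝ, 0 < u ∧ z = h u + t * u}

/-- Upper Legendre envelope `h^⋆`. -/
def upperEnv (h : ℝ → ℝ) (t : ℝ) : ℝ :=
  sSup {z : ℝ | ∃ s : ℝ, 0 ≤ s ∧ z = h s - t * s}

/-- `(((ω^ι)^α)_⋆)^{1/α}` (which equals `ω ⋆̌ id^{1/α}`). -/
def lowerCompose (ω : ℝ → ℝ) (α : ℝ) (t : ℝ) : ℝ :=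
  lowerEnv (fun u : ℝ => ω (1 / u ^ α)) (t ^ (1 / α))

/-- `(((ω^α)^⋆)^ι)^{1/α}` (which equals `ω ⋆̂ id^{1/α}`). -/
def upperCompose (ω : ℝ → ℝ) (α : ℝ) (t : ℝ) : ℝ :=
  upperEnv (fun s : ℝ => ω (s ^ α)) (1 / t ^ (1 / α))

/-- Equivalence `σ ∼ τ` of weight functions. -/
def WeightEquiv (σ τ : ℝ → ℝ) : Prop :=
  σ =O[atTop] τ ∧ τ =O[atTop] σ

/-- Relation `M ≼ N` for sequences: `sup_{p ≥ 1} (M_p/N_p)^{1/p} < ∞`. -/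
def seqPrec (M N : ℕ → ℝ) : Prop :=
  ∃ C : ℝ, ∀ p : ℕ, 1 ≤ p → (M p / N p) ^ (1 / (p : ℝ)) ≤ C

/-- Relation `M ◁ N` for sequences: `(M_p/N_p)^{1/p} → 0`. -/
def seqTriangle (M N : ℕ → ℝ) : Prop :=
  Tendsto (fun p : ℕ => (M p / N p) ^ (1 / (p : ℝ))) atTop (𝓝 0)

/-- Equivalence `M ≈ N` of sequences. -/
def seqEquiv (M N : ℕ → ℝ) : Prop := seqPrec M N ∧ seqPrec N M

/-- The Gevrey sequence `G^α`. -/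
def gevrey (α : ℝ) (p : ℕ) : ℝ := (p.factorial : ℝ) ^ α

/-- The quotient sequence `μ_p = M_p / M_{p-1}`, `μ₀ = 1`. -/
def quotSeq (M : ℕ → ℝ) : ℕ → ℝ
  | 0 => 1
  | (p + 1) => M (p + 1) / M p

/-- Condition `(β,Q)`: `liminf_{p} μ_{Qp}/μ_p > Q^β`. -/
def condBQ (M : ℕ → ℝ) (β : ℝ) (Q : ℕ) : Prop :=
  ((((Q : ℝ) ^ β : ℝ)) : EReal) <
    liminf (fun p : ℕ => ((quotSeq M (Q * p) / quotSeq M p : ℝ) : EReal)) atTop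

/-- Thilliez's growth index `γ(M) ∈ [0,∞]`. -/
def thilliezIdx (M : ℕ → ℝ) : ℝ≥0∞ :=
  ⨆ (β : ℝ) (_ : 0 ≤ β ∧ ∃ Q : ℕ, 2 ≤ Q ∧ condBQ M β Q), ENNReal.ofReal β

/-- The Beurling Gelfand-Shilov space `S_(σ)(ℝ)` (membership predicate). -/
def MemSBeurling (σ : ℝ → ℝ) (f : ℝ → ℂ) : Prop :=
  ContDiff ℝ (⊤ : ℕ∞) f ∧ ∀ ℓ : ℝ, 0 < ℓ → ∃ C : ℝ, ∀ x : ℝ, ∀ j k : ℕ,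
    (1 + |x|) ^ k * ‖iteratedDeriv j f x‖ ≤ C * assocSeq σ ℓ (j + k)

/-- The polynomial `ψ(x) = x² + 1/4`. -/
def psiMap (x : ℝ) : ℝ := x ^ 2 + 1 / 4

/-- The resolvent operator `R_μ = ∑_m C_{ψ_m}/μ^{m+1}`. -/
def Rres (μ : ℂ) (f : ℝ → ℂ) (x : ℝ) : ℂ :=
  ∑' m : ℕ, (μ ^ (m + 1))⁻¹ * f (psiMap^[m] x)

/-! ### The growth properties in power form -/

/-- Power form of `gammaProp`: sublinear growth along the scale `λ ↦ λ ^ g`. -/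
def PowUpper (f : ℝ → ℝ) (g : ℝ) : Prop :=
  ∀ ε > 0, ∀ᶠ K : ℝ in atTop, ∀ᶠ t in atTop, f (K ^ g * t) ≤ ε * K * f t

/-- Power form of `gammaBarProp`: superlinear growth along the scale `λ ↦ λ ^ g`. -/
def PowLower (f : ℝ → ℝ) (g : ℝ) : Prop :=
  ∀ D > 0, ∀ᶠ K : ℝ in atTop, ∀ᶠ t in atTop, D * K * f t ≤ f (K ^ g * t)

lemma gammaProp_of_eventually_le {f : ℝ → ℝ} (hf : Tendsto f atTop atTop) {g K q : ℝ}
    (hK : 1 < K) (hq : q < K) (h : ∀ᶠ t in atTop, f (K ^ g * t) ≤ q * f t) : gammaProp f g := by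
  refine ⟨K, hK, lt_of_le_of_lt (limsup_le_of_le (a := (q : EReal)) ?_ ?_) (by exact_mod_cast hq)⟩
  · isBoundedDefault
  · filter_upwards [h, hf.eventually_gt_atTop 0] with t ht hpos
    exact_mod_cast (div_le_iff₀ hpos).2 ht

lemma gammaBarProp_of_eventually_le {f : ℝ → ℝ} (hf : Tendsto f atTop atTop) {g K q : ℝ}
    (hK : 1 < K) (hq : K < q) (h : ∀ᶠ t in atTop, q * f t ≤ f (K ^ g * t)) :
    gammaBarProp f g := by
  refine ⟨K, hK, lt_of_lt_of_le (by exact_mod_cast hq) (le_liminf_of_le (a := (q : EReal)) ?_ ?_)⟩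
  · isBoundedDefault
  · filter_upwards [h, hf.eventually_gt_atTop 0] with t ht hpos
    exact_mod_cast (le_div_iff₀ hpos).2 ht

lemma PowUpper.gammaProp {f : ℝ → ℝ} (hf : Tendsto f atTop atTop) {g : ℝ}
    (h : PowUpper f g) : gammaProp f g := by
  obtain ⟨K, hK, hK1⟩ := ((h (1 / 2) (by norm_num)).and (eventually_gt_atTop 1)).exists
  exact gammaProp_of_eventually_le hf hK1 (by linarith) hK

lemma PowLower.gammaBarProp {f : ℝ → ℝ} (hf : Tendsto f atTop atTop) {g : ℝ}
    (h : PowLower f g) : gammaBarProp f g := by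
  obtain ⟨K, hK, hK1⟩ := ((h 2 (by norm_num)).and (eventually_gt_atTop 1)).exists
  exact gammaBarProp_of_eventually_le hf hK1 (by linarith) hK

lemma powUpper_of_gammaProp {f : ℝ → ℝ} (hf : IsWeightFct f) {g : ℝ} (hg : 0 < g)
    (h : gammaProp f g) : PowUpper f g := by
  obtain ⟨hf0, hmono, htop⟩ := hf
  obtain ⟨K, hK, hlim⟩ := h
  obtain ⟨q₀, hq₀, hq₀K⟩ := EReal.lt_iff_exists_real_btwn.1 hlim
  have hq₀K : q₀ < K := by exact_mod_cast hq₀K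
  set q := max q₀ 1
  have hq1 : 1 ≤ q := le_max_right _ _
  have hqK : q < K := max_lt hq₀K hK
  have hK0 : 0 < K := by linarith
  have hstep : ∀ᶠ t in atTop, f (K ^ g * t) ≤ q * f t := by
    filter_upwards [eventually_lt_of_limsup_lt hq₀, htop.eventually_gt_atTop 0] with t ht hpos
    have ht' : f (K ^ g * t) / f t < q₀ := by exact_mod_cast ht
    exact ((div_le_iff₀ hpos).1 ht'.le).trans
      (mul_le_mul_of_nonneg_right (le_max_left _ _) hpos.le)
  obtain ⟨t₀, ht₀⟩ := eventually_atTop.1 (hstep.and (eventually_ge_atTop 0))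
  have hKg : 1 < K ^ g := Real.one_lt_rpow hK hg
  have hiter : ∀ n : ℕ, ∀ x ≥ t₀, f ((K ^ g) ^ n * x) ≤ q ^ n * f x := by
    intro n x hx
    induction n with
    | zero => simp
    | succ n ih =>
      have hx0 := (ht₀ x hx).2
      have h1 : x ≤ (K ^ g) ^ n * x := le_mul_of_one_le_left hx0 (one_le_pow₀ hKg.le)
      have h2 := (ht₀ _ (hx.trans h1)).1
      calc f ((K ^ g) ^ (n + 1) * x) = f (K ^ g * ((K ^ g) ^ n * x)) := by ring_nf
        _ ≤ q * f ((K ^ g) ^ n * x) := h2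
        _ ≤ q * (q ^ n * f x) := by gcongr
        _ = q ^ (n + 1) * f x := by ring
  intro ε hε
  have hlim0 : Tendsto (fun n : ℕ => (q / K) ^ n * K) atTop (𝓝 (0 * K)) :=
    (tendsto_pow_atTop_nhds_zero_of_lt_one (by positivity) ((div_lt_one hK0).2 hqK)).mul_const K
  rw [zero_mul] at hlim0
  obtain ⟨N, hN⟩ := eventually_atTop.1 (hlim0.eventually_le_const hε)
  filter_upwards [eventually_ge_atTop (K ^ N)] with L hL
  have hL1 : 1 ≤ L := (one_le_pow₀ hK.le).trans hL
  obtain ⟨n, hn1, hn2⟩ := exists_nat_pow_near hL1 hK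
  have hNn : N ≤ n + 1 := ((pow_lt_pow_iff_right₀ hK).1 (hL.trans_lt hn2)).le
  filter_upwards [eventually_ge_atTop t₀] with x hx
  have hx0 := (ht₀ x hx).2
  have hLg : L ^ g ≤ (K ^ g) ^ (n + 1) := by
    rw [← Real.rpow_natCast, ← Real.rpow_mul hK0.le, mul_comm g, Real.rpow_mul hK0.le,
      Real.rpow_natCast]
    exact Real.rpow_le_rpow (by linarith) hn2.le hg.le
  have hq : q ^ (n + 1) ≤ ε * L := by
    calc q ^ (n + 1) = ((q / K) ^ (n + 1) * K) * K ^ n := by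
          rw [div_pow]; field_simp; ring
      _ ≤ ε * L := by
          gcongr
          exact hN _ hNn
  calc f (L ^ g * x) ≤ f ((K ^ g) ^ (n + 1) * x) :=
        hmono (mem_Ici.2 (by positivity)) (mem_Ici.2 (by positivity)) (by gcongr)
    _ ≤ q ^ (n + 1) * f x := hiter _ x hx
    _ ≤ ε * L * f x := mul_le_mul_of_nonneg_right hq (hf0 x)

lemma powLower_of_gammaBarProp {f : ℝ → ℝ} (hf : IsWeightFct f) {g : ℝ} (hg : 0 < g)
    (h : gammaBarProp f g) : PowLower f g := by
  obtain ⟨hf0, hmono, htop⟩ := hf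
  obtain ⟨K, hK, hlim⟩ := h
  obtain ⟨q, hKq, hq⟩ := EReal.lt_iff_exists_real_btwn.1 hlim
  have hKq : K < q := by exact_mod_cast hKq
  have hK0 : 0 < K := by linarith
  have hq0 : 0 < q := by linarith
  have hstep : ∀ᶠ t in atTop, q * f t ≤ f (K ^ g * t) := by
    filter_upwards [eventually_lt_of_lt_liminf hq, htop.eventually_gt_atTop 0] with t ht hpos
    have ht' : q < f (K ^ g * t) / f t := by exact_mod_cast ht
    exact (le_div_iff₀ hpos).1 ht'.le
  obtain ⟨t₀, ht₀⟩ := eventually_atTop.1 (hstep.and (eventually_ge_atTop 0))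
  have hKg : 1 < K ^ g := Real.one_lt_rpow hK hg
  have hiter : ∀ n : ℕ, ∀ x ≥ t₀, q ^ n * f x ≤ f ((K ^ g) ^ n * x) := by
    intro n x hx
    induction n with
    | zero => simp
    | succ n ih =>
      have hx0 := (ht₀ x hx).2
      have h1 : x ≤ (K ^ g) ^ n * x := le_mul_of_one_le_left hx0 (one_le_pow₀ hKg.le)
      have h2 := (ht₀ _ (hx.trans h1)).1
      calc q ^ (n + 1) * f x = q * (q ^ n * f x) := by ring
        _ ≤ q * f ((K ^ g) ^ n * x) := by gcongr
        _ ≤ f (K ^ g * ((K ^ g) ^ n * x)) := h2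
        _ = f ((K ^ g) ^ (n + 1) * x) := by ring_nf
  intro D hD
  obtain ⟨N, hN⟩ := eventually_atTop.1
    ((tendsto_pow_atTop_atTop_of_one_lt ((one_lt_div hK0).2 hKq)).eventually_ge_atTop (D * K))
  filter_upwards [eventually_ge_atTop (K ^ N)] with L hL
  have hL1 : 1 ≤ L := (one_le_pow₀ hK.le).trans hL
  obtain ⟨n, hn1, hn2⟩ := exists_nat_pow_near hL1 hK
  have hNn : N ≤ n := Nat.lt_succ_iff.1 ((pow_lt_pow_iff_right₀ hK).1 (hL.trans_lt hn2))
  filter_upwards [eventually_ge_atTop t₀] with x hx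
  have hx0 := (ht₀ x hx).2
  have hLg : (K ^ g) ^ n ≤ L ^ g := by
    rw [← Real.rpow_natCast, ← Real.rpow_mul hK0.le, mul_comm g, Real.rpow_mul hK0.le,
      Real.rpow_natCast]
    exact Real.rpow_le_rpow (by positivity) hn1 hg.le
  have hq : D * L ≤ q ^ n := by
    calc D * L ≤ D * K ^ (n + 1) := by gcongr
      _ = (D * K) * K ^ n := by ring
      _ ≤ (q / K) ^ n * K ^ n := by
          gcongr
          exact hN _ hNn
      _ = q ^ n := by rw [div_pow]; field_simp
  calc D * L * f x ≤ q ^ n * f x := mul_le_mul_of_nonneg_right hq (hf0 x)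
    _ ≤ f ((K ^ g) ^ n * x) := hiter _ x hx
    _ ≤ f (L ^ g * x) :=
        hmono (mem_Ici.2 (by positivity)) (mem_Ici.2 (by positivity)) (by gcongr)

lemma tendsto_rpow_mul_atTop {K : ℝ} (hK : 1 < K) (g : ℝ) :
    Tendsto (fun t : ℝ => K ^ g * t) atTop atTop :=
  tendsto_id.const_mul_atTop (Real.rpow_pos_of_pos (by linarith) g)

lemma PowUpper.congr {f h : ℝ → ℝ} {c C g : ℝ} (hc : 0 < c) (hC : 0 < C)
    (h1 : ∀ᶠ t in atTop, c * f t ≤ h t) (h2 : ∀ᶠ t in atTop, h t ≤ C * f t)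
    (H : PowUpper f g) : PowUpper h g := by
  intro ε hε
  filter_upwards [H (ε * c / C) (by positivity), eventually_gt_atTop 1] with K hK hK1
  filter_upwards [hK, h1, (tendsto_rpow_mul_atTop hK1 g).eventually h2] with t e1 e2 e3
  calc h (K ^ g * t) ≤ C * f (K ^ g * t) := e3
    _ ≤ C * (ε * c / C * K * f t) := by gcongr
    _ = ε * K * (c * f t) := by field_simp
    _ ≤ ε * K * h t := by gcongr

lemma PowLower.congr {f h : ℝ → ℝ} {c C g : ℝ} (hc : 0 < c) (hC : 0 < C)
    (h1 : ∀ᶠ t in atTop, c * f t ≤ h t) (h2 : ∀ᶠ t in atTop, h t ≤ C * f t)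
    (H : PowLower f g) : PowLower h g := by
  intro D hD
  filter_upwards [H (D * C / c) (by positivity), eventually_gt_atTop 1] with K hK hK1
  filter_upwards [hK, h2, (tendsto_rpow_mul_atTop hK1 g).eventually h1] with t e1 e2 e3
  calc D * K * h t ≤ D * K * (C * f t) := by gcongr
    _ = c * (D * C / c * K * f t) := by field_simp
    _ ≤ c * f (K ^ g * t) := by gcongr
    _ ≤ h (K ^ g * t) := e3

lemma gammaProp_iff_powUpper {f : ℝ → ℝ} (hf : IsWeightFct f) {g : ℝ} (hg : 0 < g) :
    gammaProp f g ↔ PowUpper f g :=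
  ⟨powUpper_of_gammaProp hf hg, PowUpper.gammaProp hf.2.2⟩

lemma gammaBarProp_iff_powLower {f : ℝ → ℝ} (hf : IsWeightFct f) {g : ℝ} (hg : 0 < g) :
    gammaBarProp f g ↔ PowLower f g :=
  ⟨powLower_of_gammaBarProp hf hg, PowLower.gammaBarProp hf.2.2⟩

/-- Pointwise comparability near infinity, up to positive constants. -/
def Comparable (f h : ℝ → ℝ) : Prop :=
  ∃ c C : ℝ, 0 < c ∧ 0 < C ∧ (∀ᶠ t in atTop, c * f t ≤ h t) ∧ ∀ᶠ t in atTop, h t ≤ C * f t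

lemma Comparable.symm {f h : ℝ → ℝ} (H : Comparable f h) : Comparable h f := by
  obtain ⟨c, C, hc, hC, h1, h2⟩ := H
  refine ⟨C⁻¹, c⁻¹, inv_pos.2 hC, inv_pos.2 hc, ?_, ?_⟩
  · filter_upwards [h2] with t ht
    exact (inv_mul_le_iff₀ hC).2 ht
  · filter_upwards [h1] with t ht
    exact (le_inv_mul_iff₀ hc).2 ht

lemma gammaProp_congr {f h : ℝ → ℝ} (hf : IsWeightFct f) (hh : IsWeightFct h)
    (H : Comparable f h) {g : ℝ} (hg : 0 < g) : gammaProp f g ↔ gammaProp h g := by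
  rw [gammaProp_iff_powUpper hf hg, gammaProp_iff_powUpper hh hg]
  obtain ⟨_, _, hc, hC, h1, h2⟩ := H.symm
  obtain ⟨_, _, hc', hC', h1', h2'⟩ := H
  exact ⟨PowUpper.congr hc' hC' h1' h2', PowUpper.congr hc hC h1 h2⟩

lemma gammaBarProp_congr {f h : ℝ → ℝ} (hf : IsWeightFct f) (hh : IsWeightFct h)
    (H : Comparable f h) {g : ℝ} (hg : 0 < g) : gammaBarProp f g ↔ gammaBarProp h g := by
  rw [gammaBarProp_iff_powLower hf hg, gammaBarProp_iff_powLower hh hg]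
  obtain ⟨_, _, hc, hC, h1, h2⟩ := H.symm
  obtain ⟨_, _, hc', hC', h1', h2'⟩ := H
  exact ⟨PowLower.congr hc' hC' h1' h2', PowLower.congr hc hC h1 h2⟩

lemma gammaIdx_congr {f h : ℝ → ℝ} (hf : IsWeightFct f) (hh : IsWeightFct h)
    (H : Comparable f h) : gammaIdx f = gammaIdx h := by
  unfold gammaIdx
  congr! 3 with g
  exact and_congr_right fun hg => gammaProp_congr hf hh H hg

lemma gammaBarIdx_congr {f h : ℝ → ℝ} (hf : IsWeightFct f) (hh : IsWeightFct h)
    (H : Comparable f h) : gammaBarIdx f = gammaBarIdx h := by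
  unfold gammaBarIdx
  congr! 3
  ext g
  exact and_congr_right fun hg => gammaBarProp_congr hf hh H hg

/-! ### The weight functions of the associated weight matrix -/

section AssociatedWeight

variable {ω : ℝ → ℝ}

lemma IsW0.apply_exp_zero (h : IsW0 ω) : ω (Real.exp 0) = 0 :=
  h.2.2.1 _ (by simp)

lemma IsW0.eventually_mul_log_le (h : IsW0 ω) {x : ℝ} (hx : 0 ≤ x) :
    ∀ᶠ t in atTop, x * Real.log t ≤ ω t := by
  filter_upwards [h.2.2.2.1.bound (show (0 : ℝ) < 1 / (x + 1) by positivity),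
    eventually_ge_atTop 1] with t ht ht1
  have hlog := Real.log_nonneg ht1
  rw [Real.norm_of_nonneg hlog, Real.norm_of_nonneg (h.1.1 t), div_mul_eq_mul_div, one_mul,
    le_div_iff₀ (by positivity)] at ht
  nlinarith

lemma IsW0.bddAbove_conj (h : IsW0 ω) {x : ℝ} (hx : 0 ≤ x) :
    BddAbove {z : ℝ | ∃ y : ℝ, 0 ≤ y ∧ z = x * y - ω (Real.exp y)} := by
  obtain ⟨y₀, hy₀⟩ := eventually_atTop.1
    (Real.tendsto_exp_atTop.eventually (h.eventually_mul_log_le hx))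
  refine ⟨x * |y₀|, ?_⟩
  rintro z ⟨y, hy, rfl⟩
  rcases le_total y₀ y with hle | hle
  · have := hy₀ y hle
    rw [Real.log_exp] at this
    have : 0 ≤ x * |y₀| := by positivity
    linarith
  · have h1 : x * y ≤ x * |y₀| := by gcongr; exact hle.trans (le_abs_self _)
    linarith [h.1.1 (Real.exp y)]

lemma IsW0.le_phiStar (h : IsW0 ω) {x y : ℝ} (hx : 0 ≤ x) (hy : 0 ≤ y) :
    x * y - ω (Real.exp y) ≤ phiStar ω x :=
  le_csSup (h.bddAbove_conj hx) ⟨y, hy, rfl⟩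

lemma phiStar_le {x B : ℝ} (hB : ∀ y, 0 ≤ y → x * y - ω (Real.exp y) ≤ B) :
    phiStar ω x ≤ B := by
  refine csSup_le ⟨_, 0, le_rfl, rfl⟩ ?_
  rintro z ⟨y, hy, rfl⟩
  exact hB y hy

lemma IsW0.phiStar_nonneg (h : IsW0 ω) {x : ℝ} (hx : 0 ≤ x) : 0 ≤ phiStar ω x := by
  simpa only [h.apply_exp_zero, mul_zero, sub_zero] using h.le_phiStar hx le_rfl

lemma IsW0.phiStar_zero (h : IsW0 ω) : phiStar ω 0 = 0 :=
  le_antisymm (phiStar_le fun y _ => by simpa using h.1.1 _) (h.phiStar_nonneg le_rfl)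

lemma IsW0.phiStar_mono (h : IsW0 ω) {x x' : ℝ} (hx : x ≤ x') (hx' : 0 ≤ x') :
    phiStar ω x ≤ phiStar ω x' :=
  phiStar_le fun y hy => (sub_le_sub_right (by gcongr) _).trans (h.le_phiStar hx' hy)

/-- The supremum in the conjugate is attained: every point has a supporting line. -/
lemma IsW0.exists_phiStar_le (h : IsW0 ω) (y : ℝ) :
    ∃ x, 0 ≤ x ∧ phiStar ω x ≤ x * y - ω (Real.exp y) := by
  obtain ⟨⟨h0, hmono, -⟩, -, -, -, hconv⟩ := h
  set φ : ℝ → ℝ := fun y => ω (Real.exp y) with hφ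
  have hφmono : Monotone φ := fun a b hab =>
    hmono (Real.exp_pos a).le (Real.exp_pos b).le (Real.exp_le_exp.2 hab)
  have hint : ∀ z : ℝ, z ∈ interior (univ : Set ℝ) := fun z => by simp
  set x := derivWithin φ (Ioi y) y
  have hright : ∀ z, y < z → x * (z - y) ≤ φ z - φ y := fun z hz => by
    have := hconv.rightDeriv_le_slope_of_mem_interior (hint y) (mem_univ z) hz
    rw [slope_def_field, le_div_iff₀ (by linarith)] at this
    exact this
  have hleft : ∀ z, z < y → φ y - φ z ≤ x * (y - z) := fun z hz => by
    have := (hconv.slope_le_leftDeriv_of_mem_interior (mem_univ z) (hint y) hz).trans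
      (hconv.leftDeriv_le_rightDeriv_of_mem_interior (hint y))
    rw [slope_def_field, div_le_iff₀ (by linarith)] at this
    exact this
  refine ⟨x, ?_, phiStar_le fun z _ => ?_⟩
  · have h1 := hleft (y - 1) (by linarith)
    have h2 := hφmono (show y - 1 ≤ y by linarith)
    linarith
  · change x * z - φ z ≤ x * y - φ y
    rcases lt_trichotomy y z with hz | rfl | hz
    · linarith [hright z hz]
    · exact le_rfl
    · linarith [hleft z hz]

lemma log_pow_div_assocSeq {ℓ t : ℝ} (ht : 0 < t) (p : ℕ) :
    Real.log (t ^ p / assocSeq ω ℓ p) = p * Real.log t - 1 / ℓ * phiStar ω (ℓ * p) := by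
  rw [assocSeq, Real.log_div (by positivity) (Real.exp_ne_zero _), Real.log_pow, Real.log_exp]

lemma IsW0.log_assocSeq_le (h : IsW0 ω) {ℓ t : ℝ} (hℓ : 0 < ℓ) (ht : 0 ≤ t) (p : ℕ) :
    Real.log (t ^ p / assocSeq ω ℓ p) ≤ ω t / ℓ := by
  have hnn : 0 ≤ ω t / ℓ := div_nonneg (h.1.1 t) hℓ.le
  have hφ : 0 ≤ 1 / ℓ * phiStar ω (ℓ * p) :=
    mul_nonneg (by positivity) (h.phiStar_nonneg (by positivity))
  rcases ht.eq_or_lt with rfl | ht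
  · rcases p.eq_zero_or_pos with rfl | hp
    · simpa [assocSeq, h.phiStar_zero] using hnn
    · simpa [zero_pow hp.ne'] using hnn
  rw [log_pow_div_assocSeq ht]
  rcases le_total t 1 with h1 | h1
  · have : (p : ℝ) * Real.log t ≤ 0 :=
      mul_nonpos_of_nonneg_of_nonpos (by positivity) (Real.log_nonpos ht.le h1)
    linarith
  · have := h.le_phiStar (show 0 ≤ ℓ * p by positivity) (Real.log_nonneg h1)
    rw [Real.exp_log ht] at this
    rw [le_div_iff₀ hℓ]
    calc (p * Real.log t - 1 / ℓ * phiStar ω (ℓ * p)) * ℓ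
        = ℓ * p * Real.log t - phiStar ω (ℓ * p) := by
          rw [sub_mul, one_div, mul_right_comm ℓ⁻¹, inv_mul_cancel₀ hℓ.ne']; ring
      _ ≤ ω t := by linarith

lemma IsW0.bddAbove_omegaSeq (h : IsW0 ω) {ℓ t : ℝ} (hℓ : 0 < ℓ) (ht : 0 ≤ t) :
    BddAbove {z : ℝ | ∃ p : ℕ, z = Real.log (t ^ p / assocSeq ω ℓ p)} := by
  refine ⟨ω t / ℓ, ?_⟩
  rintro z ⟨p, rfl⟩
  exact h.log_assocSeq_le hℓ ht p

lemma IsW0.omegaSeq_le (h : IsW0 ω) {ℓ t : ℝ} (hℓ : 0 < ℓ) (ht : 0 ≤ t) :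
    omegaSeq (assocSeq ω ℓ) t ≤ ω t / ℓ := by
  refine csSup_le ⟨_, 0, rfl⟩ ?_
  rintro z ⟨p, rfl⟩
  exact h.log_assocSeq_le hℓ ht p

lemma IsW0.sub_log_le_omegaSeq (h : IsW0 ω) {ℓ t : ℝ} (hℓ : 0 < ℓ) (ht : 1 ≤ t) :
    ω t / ℓ - Real.log t ≤ omegaSeq (assocSeq ω ℓ) t := by
  have ht0 : 0 < t := by linarith
  have hlog := Real.log_nonneg ht
  obtain ⟨x, hx0, hx⟩ := h.exists_phiStar_le (Real.log t)
  rw [Real.exp_log ht0] at hx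
  set p := ⌊x / ℓ⌋₊
  have hp1 : ℓ * p ≤ x := by
    have := Nat.floor_le (show 0 ≤ x / ℓ by positivity)
    rwa [le_div_iff₀' hℓ] at this
  have hp2 : x ≤ ℓ * (p + 1) := by
    have := (Nat.lt_floor_add_one (x / ℓ)).le
    rwa [div_le_iff₀' hℓ] at this
  refine le_trans ?_ (le_csSup (h.bddAbove_omegaSeq hℓ ht0.le) ⟨p, rfl⟩)
  rw [log_pow_div_assocSeq ht0]
  have h1 := (h.phiStar_mono hp1 hx0).trans hx
  have h2 := mul_le_mul_of_nonneg_right hp2 hlog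
  rw [sub_le_iff_le_add, div_le_iff₀ hℓ]
  calc ω t ≤ ℓ * p * Real.log t - phiStar ω (ℓ * p) + ℓ * Real.log t := by linarith
    _ = (p * Real.log t - 1 / ℓ * phiStar ω (ℓ * p) + Real.log t) * ℓ := by
        rw [add_mul, sub_mul, one_div, mul_right_comm ℓ⁻¹, inv_mul_cancel₀ hℓ.ne']; ring

lemma IsW0.comparable_omegaSeq (h : IsW0 ω) {ℓ : ℝ} (hℓ : 0 < ℓ) :
    Comparable ω (omegaSeq (assocSeq ω ℓ)) := by
  refine ⟨1 / (2 * ℓ), 1 / ℓ, by positivity, by positivity, ?_, ?_⟩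
  · filter_upwards [h.eventually_mul_log_le (show 0 ≤ 2 * ℓ by positivity),
      eventually_ge_atTop 1] with t h1 h2
    refine le_trans ?_ (h.sub_log_le_omegaSeq hℓ h2)
    rw [le_sub_iff_add_le, le_div_iff₀ hℓ]
    field_simp
    linarith
  · filter_upwards [eventually_ge_atTop 0] with t ht
    simpa [div_eq_inv_mul] using h.omegaSeq_le hℓ ht

lemma IsW0.isWeightFct_omegaSeq (h : IsW0 ω) {ℓ : ℝ} (hℓ : 0 < ℓ) :
    IsWeightFct (omegaSeq (assocSeq ω ℓ)) := by
  have hnn : ∀ t, 0 ≤ omegaSeq (assocSeq ω ℓ) t := fun t =>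
    Real.sSup_nonneg' ⟨0, ⟨0, by simp [assocSeq, h.phiStar_zero]⟩, le_rfl⟩
  refine ⟨hnn, fun s hs t ht hst => ?_, ?_⟩
  · refine csSup_le ⟨_, 0, rfl⟩ ?_
    rintro z ⟨p, rfl⟩
    rcases (mem_Ici.1 hs).eq_or_lt with rfl | hs0
    · rcases p.eq_zero_or_pos with rfl | hp
      · simpa [assocSeq, h.phiStar_zero] using hnn t
      · simpa [zero_pow hp.ne'] using hnn t
    · refine le_trans ?_ (le_csSup (h.bddAbove_omegaSeq hℓ ht) ⟨p, rfl⟩)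
      rw [log_pow_div_assocSeq hs0, log_pow_div_assocSeq (hs0.trans_le hst)]
      have := Real.log_le_log hs0 hst
      gcongr
  · obtain ⟨c, _, hc, _, h1, _⟩ := h.comparable_omegaSeq hℓ
    exact tendsto_atTop_mono' _ h1 (h.1.2.2.const_mul_atTop hc)

end AssociatedWeight

/-! ### Growth of the generalized upper Legendre conjugate -/

section UpperConj

variable {s T : ℝ → ℝ}

lemma UpperConjWD.le_upperConj (hwd : UpperConjWD s T) {t u : ℝ} (ht : 0 < t) (hu : 0 ≤ u) :
    s u - T (u / t) ≤ upperConj s T t := by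
  rw [upperConj, if_neg ht.ne']
  exact le_csSup (hwd t ht) ⟨u, hu, rfl⟩

lemma upperConj_le {t B : ℝ} (ht : 0 < t) (hB : ∀ u, 0 ≤ u → s u - T (u / t) ≤ B) :
    upperConj s T t ≤ B := by
  rw [upperConj, if_neg ht.ne']
  refine csSup_le ⟨_, 0, le_rfl, rfl⟩ ?_
  rintro z ⟨u, hu, rfl⟩
  exact hB u hu

lemma upperConjWD_of_powUpper (hs : IsWeightFct s) (hT : IsWeightFct T) (hlo : s =o[atTop] T)
    {g : ℝ} (hg : 0 < g) (h : PowUpper s g) : UpperConjWD s T := by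
  intro t ht
  obtain ⟨K, hK, hK1, hKt⟩ := ((h 1 one_pos).and ((eventually_ge_atTop 1).and
    ((tendsto_rpow_atTop hg).eventually_ge_atTop t))).exists
  have hK0 : 0 < K := by linarith
  have hev : ∀ᶠ v in atTop, s (K ^ g * v) ≤ T v := by
    filter_upwards [hK, hlo.bound (show (0 : ℝ) < 1 / K by positivity)] with v h1 h2
    rw [Real.norm_of_nonneg (hs.1 v), Real.norm_of_nonneg (hT.1 v), div_mul_eq_mul_div, one_mul,
      le_div_iff₀' hK0] at h2
    linarith
  obtain ⟨v₀, hv₀⟩ := eventually_atTop.1 hev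
  refine ⟨s (|v₀| * t), ?_⟩
  rintro z ⟨u, hu, rfl⟩
  rcases le_total |v₀| (u / t) with hle | hle
  · have h1 := hv₀ (u / t) ((le_abs_self _).trans hle)
    have h2 : s u ≤ s (K ^ g * (u / t)) := by
      have : u = t * (u / t) := by field_simp
      refine hs.2.1 hu (mem_Ici.2 (by positivity)) ?_
      calc u = t * (u / t) := this
        _ ≤ K ^ g * (u / t) := by gcongr
    linarith [hs.1 (|v₀| * t)]
  · have h1 : s u ≤ s (|v₀| * t) :=
      hs.2.1 hu (mem_Ici.2 (by positivity)) ((div_le_iff₀ ht).1 hle)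
    linarith [hT.1 (u / t)]

lemma tendsto_upperConj (hs : IsWeightFct s) (hwd : UpperConjWD s T) :
    Tendsto (upperConj s T) atTop atTop := by
  refine tendsto_atTop_mono' _ ?_ (tendsto_atTop_add_const_right _ (-T 1) hs.2.2)
  filter_upwards [eventually_gt_atTop 0] with t ht
  simpa [div_self ht.ne', sub_eq_add_neg] using hwd.le_upperConj ht ht.le

lemma upperConj_mul_le (hs : IsWeightFct s) (hT : IsWeightFct T) (hwd : UpperConjWD s T)
    {μ ν q : ℝ} (hμ : 0 < μ) (hν : 0 < ν) (hq : 0 ≤ q)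
    (h1 : ∀ᶠ x in atTop, s (μ * x) ≤ q * s x) (h2 : ∀ᶠ x in atTop, q * T x ≤ T (ν * x)) :
    ∃ C, ∀ᶠ t in atTop, upperConj s T (μ / ν * t) ≤ q * upperConj s T t + C := by
  obtain ⟨x₀, hx₀⟩ := eventually_atTop.1 h1
  obtain ⟨x₁, hx₁⟩ := eventually_atTop.1 (h2.and (eventually_ge_atTop 1))
  have hx₁1 := (hx₁ x₁ le_rfl).2
  have hx₁0 : 0 < x₁ := by linarith
  refine ⟨q * T x₁, ?_⟩
  filter_upwards [eventually_gt_atTop 0, eventually_ge_atTop x₀] with t ht htx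
  have hle : x₀ ≤ x₁ * t := htx.trans (le_mul_of_one_le_left ht.le hx₁1)
  refine upperConj_le (by positivity) fun u hu => ?_
  obtain ⟨v, rfl⟩ : ∃ v, u = μ * v := ⟨u / μ, by field_simp⟩
  have hv : 0 ≤ v := nonneg_of_mul_nonneg_right hu hμ
  have harg : μ * v / (μ / ν * t) = ν * (v / t) := by field_simp
  rw [harg]
  rcases le_total (x₁ * t) v with hxv | hxv
  · have e1 := hx₀ v (hle.trans hxv)
    have e2 := (hx₁ (v / t) ((le_div_iff₀ ht).2 hxv)).1
    have e3 := mul_le_mul_of_nonneg_left (hwd.le_upperConj ht hv) hq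
    have e4 : 0 ≤ q * T x₁ := mul_nonneg hq (hT.1 _)
    linarith
  · have e1 : s (μ * v) ≤ s (μ * (x₁ * t)) :=
      hs.2.1 hu (mem_Ici.2 (by positivity)) (by gcongr)
    have e2 := hx₀ _ hle
    have e3 := mul_le_mul_of_nonneg_left
      (hwd.le_upperConj ht (show 0 ≤ x₁ * t by positivity)) hq
    rw [mul_div_cancel_right₀ _ ht.ne'] at e3
    linarith [hT.1 (ν * (v / t))]

lemma mul_upperConj_le (hs : IsWeightFct s) (hT : IsWeightFct T) (hwd : UpperConjWD s T)
    {μ ν q : ℝ} (hμ : 0 < μ) (hν : 0 < ν) (hq : 0 < q)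
    (h1 : ∀ᶠ x in atTop, q * s x ≤ s (μ * x)) (h2 : ∀ᶠ x in atTop, T (ν * x) ≤ q * T x) :
    ∃ C, ∀ᶠ t in atTop, q * upperConj s T t ≤ upperConj s T (μ / ν * t) + C := by
  obtain ⟨x₀, hx₀⟩ := eventually_atTop.1 h1
  obtain ⟨x₁, hx₁⟩ := eventually_atTop.1 (h2.and (eventually_ge_atTop 1))
  have hx₁1 := (hx₁ x₁ le_rfl).2
  have hx₁0 : 0 < x₁ := by linarith
  refine ⟨T (ν * x₁), ?_⟩
  filter_upwards [eventually_gt_atTop 0, eventually_ge_atTop x₀] with t ht htx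
  have hle : x₀ ≤ x₁ * t := htx.trans (le_mul_of_one_le_left ht.le hx₁1)
  have hkey : ∀ v, 0 ≤ v → s (μ * v) - T (ν * (v / t)) ≤ upperConj s T (μ / ν * t) := by
    intro v hv
    have harg : μ * v / (μ / ν * t) = ν * (v / t) := by field_simp
    have := hwd.le_upperConj (show 0 < μ / ν * t by positivity) (show 0 ≤ μ * v by positivity)
    rwa [harg] at this
  rw [← le_div_iff₀' hq]
  refine upperConj_le ht fun v hv => ?_
  rw [le_div_iff₀' hq]
  rcases le_total (x₁ * t) v with hxv | hxv
  · have e1 := hx₀ v (hle.trans hxv)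
    have e2 := (hx₁ (v / t) ((le_div_iff₀ ht).2 hxv)).1
    linarith [hkey v hv, hT.1 (ν * x₁)]
  · have e1 : q * s v ≤ q * s (x₁ * t) :=
      mul_le_mul_of_nonneg_left (hs.2.1 hv (mem_Ici.2 (by positivity)) hxv) hq.le
    have e2 := hx₀ _ hle
    have e3 := hkey (x₁ * t) (by positivity)
    rw [mul_div_cancel_right₀ _ ht.ne'] at e3
    linarith [mul_nonneg hq.le (hT.1 (v / t))]

lemma gammaProp_upperConj (hs : IsWeightFct s) (hT : IsWeightFct T) (hwd : UpperConjWD s T)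
    {a b : ℝ} (ha : PowUpper s a) (hb : PowLower T b) : gammaProp (upperConj s T) (a - b) := by
  obtain ⟨K, hK1, hsK, hTK⟩ := ((eventually_gt_atTop 1).and
    ((ha (1 / 2) (by norm_num)).and (hb (1 / 2) (by norm_num)))).exists
  have hK0 : 0 < K := by linarith
  obtain ⟨C, hC⟩ := upperConj_mul_le hs hT hwd (Real.rpow_pos_of_pos hK0 a)
    (Real.rpow_pos_of_pos hK0 b) (by positivity) hsK hTK
  have htop := tendsto_upperConj hs hwd
  refine gammaProp_of_eventually_le htop hK1 (show 3 / 4 * K < K by linarith) ?_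
  filter_upwards [hC, (htop.const_mul_atTop (show 0 < 1 / 4 * K by positivity)).eventually_ge_atTop
    C] with t h1 h2
  rw [Real.rpow_sub hK0]
  linarith

lemma gammaBarProp_upperConj (hs : IsWeightFct s) (hT : IsWeightFct T) (hwd : UpperConjWD s T)
    {a b : ℝ} (ha : PowLower s a) (hb : PowUpper T b) :
    gammaBarProp (upperConj s T) (a - b) := by
  obtain ⟨K, hK1, hsK, hTK⟩ := ((eventually_gt_atTop 1).and
    ((ha 2 (by norm_num)).and (hb 2 (by norm_num)))).exists
  have hK0 : 0 < K := by linarith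
  obtain ⟨C, hC⟩ := mul_upperConj_le hs hT hwd (Real.rpow_pos_of_pos hK0 a)
    (Real.rpow_pos_of_pos hK0 b) (by positivity) hsK hTK
  have htop := tendsto_upperConj hs hwd
  refine gammaBarProp_of_eventually_le htop hK1 (show K < 3 / 2 * K by linarith) ?_
  filter_upwards [hC, (htop.const_mul_atTop (show 0 < 1 / 2 * K by positivity)).eventually_ge_atTop
    C] with t h1 h2
  rw [Real.rpow_sub hK0]
  linarith

lemma upperConjWD_of_gammaIdx_pos (hs : IsWeightFct s) (hT : IsWeightFct T)
    (hlo : s =o[atTop] T) (h : 0 < gammaIdx s) : UpperConjWD s T := by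
  simp only [gammaIdx, lt_iSup_iff] at h
  obtain ⟨g, ⟨hg, hsg⟩, -⟩ := h
  exact upperConjWD_of_powUpper hs hT hlo hg (powUpper_of_gammaProp hs hg hsg)

lemma gammaIdx_le_upperConj_add (hs : IsWeightFct s) (hT : IsWeightFct T)
    (hwd : UpperConjWD s T) :
    gammaIdx s ≤ gammaIdx (upperConj s T) + gammaBarIdx T := by
  refine iSup₂_le fun a ⟨ha, hsa⟩ => ?_
  rw [gammaBarIdx, ENNReal.add_sInf]
  refine le_iInf₂ ?_
  rintro _ ⟨b, ⟨hb, hTb⟩, rfl⟩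
  rcases le_or_gt a b with hab | hab
  · exact (ENNReal.ofReal_le_ofReal hab).trans le_add_self
  · have hprop := gammaProp_upperConj hs hT hwd (powUpper_of_gammaProp hs ha hsa)
      (powLower_of_gammaBarProp hT hb hTb)
    calc ENNReal.ofReal a = ENNReal.ofReal (a - b) + ENNReal.ofReal b := by
          rw [← ENNReal.ofReal_add (by linarith) hb.le, sub_add_cancel]
      _ ≤ gammaIdx (upperConj s T) + ENNReal.ofReal b := by
          gcongr
          exact le_iSup₂_of_le (a - b) ⟨by linarith, hprop⟩ le_rfl

lemma gammaBarIdx_upperConj_add_le (hs : IsWeightFct s) (hT : IsWeightFct T)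
    (hwd : UpperConjWD s T) (hpos : 0 < gammaIdx T) (hlt : gammaIdx T < gammaBarIdx s) :
    gammaBarIdx (upperConj s T) + gammaIdx T ≤ gammaBarIdx s := by
  refine le_sInf ?_
  rintro _ ⟨a, ⟨ha, hsa⟩, rfl⟩
  have hTa : gammaIdx T < ENNReal.ofReal a :=
    hlt.trans_le (sInf_le ⟨a, ⟨ha, hsa⟩, rfl⟩)
  have hb_lt : ∀ b, 0 < b ∧ gammaProp T b → b < a := fun b hb =>
    (ENNReal.ofReal_lt_ofReal_iff ha).1
      ((le_iSup₂ (f := fun (g : ℝ) (_ : 0 < g ∧ gammaProp T g) => ENNReal.ofReal g) b hb).trans_lt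
        hTa)
  have hle : ∀ b, 0 < b ∧ gammaProp T b →
      gammaBarIdx (upperConj s T) + ENNReal.ofReal b ≤ ENNReal.ofReal a := by
    intro b hb
    have hba := hb_lt b hb
    have hprop := gammaBarProp_upperConj hs hT hwd (powLower_of_gammaBarProp hs ha hsa)
      (powUpper_of_gammaProp hT hb.1 hb.2)
    calc gammaBarIdx (upperConj s T) + ENNReal.ofReal b
        ≤ ENNReal.ofReal (a - b) + ENNReal.ofReal b := by
          gcongr
          exact sInf_le ⟨a - b, ⟨by linarith, hprop⟩, rfl⟩
      _ = ENNReal.ofReal a := by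
          rw [← ENNReal.ofReal_add (by linarith) hb.1.le, sub_add_cancel]
  have hκ : gammaBarIdx (upperConj s T) ≤ ENNReal.ofReal a := by
    simp only [gammaIdx, lt_iSup_iff] at hpos
    obtain ⟨b, hb, -⟩ := hpos
    exact le_self_add.trans (hle b hb)
  have hκtop : gammaBarIdx (upperConj s T) ≠ ⊤ := (hκ.trans_lt ENNReal.ofReal_lt_top).ne
  rw [← ENNReal.le_sub_iff_add_le_left hκtop hκ]
  refine iSup₂_le fun b hb => ?_
  rw [ENNReal.le_sub_iff_add_le_left hκtop hκ]
  exact hle b hb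

end UpperConj

lemma isLittleO_omegaSeq {σ τ : ℝ → ℝ} (hσ : IsW0 σ) (hτ : IsW0 τ) (hlo : σ =o[atTop] τ)
    {ℓ j : ℝ} (hℓ : 0 < ℓ) (hj : 0 < j) :
    omegaSeq (assocSeq σ ℓ) =o[atTop] omegaSeq (assocSeq τ j) := by
  have hO : ∀ {f h : ℝ → ℝ}, IsWeightFct f → IsWeightFct h → Comparable f h →
      h =O[atTop] f := by
    rintro f h hf hh ⟨_, C, _, _, _, hC⟩
    refine IsBigO.of_bound C ?_
    filter_upwards [hC] with t ht
    rwa [Real.norm_of_nonneg (hf.1 t), Real.norm_of_nonneg (hh.1 t)]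
  exact ((hO hσ.1 (hσ.isWeightFct_omegaSeq hℓ) (hσ.comparable_omegaSeq hℓ)).trans_isLittleO
    hlo).trans_isBigO
      (hO (hτ.isWeightFct_omegaSeq hj) hτ.1 (hτ.comparable_omegaSeq hj).symm)

theorem stmt17 (σ τ : ℝ → ℝ) (hσ : IsW0 σ) (hτ : IsW0 τ)
    (hlo : σ =o[atTop] τ) :
    (gammaBarIdx τ < gammaIdx σ →
      ∀ ℓ : ℝ, 0 < ℓ → ∀ ℓ₁ : ℝ, 0 < ℓ₁ → ∀ j : ℝ, 0 < j → ∀ j₁ : ℝ, 0 < j₁ →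
        gammaIdx (omegaSeq (assocSeq σ ℓ₁))
          ≤ gammaIdx (upperConj (omegaSeq (assocSeq σ ℓ)) (omegaSeq (assocSeq τ j)))
              + gammaBarIdx (omegaSeq (assocSeq τ j₁))) ∧
    (0 < gammaIdx τ → gammaIdx τ ≤ gammaBarIdx τ → gammaBarIdx τ < gammaIdx σ →
      gammaIdx σ ≤ gammaBarIdx σ → gammaBarIdx σ < ⊤ →
      ∀ ℓ : ℝ, 0 < ℓ → ∀ ℓ₁ : ℝ, 0 < ℓ₁ → ∀ j : ℝ, 0 < j → ∀ j₁ : ℝ, 0 < j₁ →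
        gammaBarIdx (upperConj (omegaSeq (assocSeq σ ℓ)) (omegaSeq (assocSeq τ j)))
            + gammaIdx (omegaSeq (assocSeq τ j₁))
          ≤ gammaBarIdx (omegaSeq (assocSeq σ ℓ₁))) := by
  have hγ : ∀ {ω : ℝ → ℝ}, IsW0 ω → ∀ {ℓ : ℝ}, 0 < ℓ →
      gammaIdx (omegaSeq (assocSeq ω ℓ)) = gammaIdx ω := fun h ℓ hℓ =>
    (gammaIdx_congr h.1 (h.isWeightFct_omegaSeq hℓ) (h.comparable_omegaSeq hℓ)).symm
  have hγbar : ∀ {ω : ℝ → ℝ}, IsW0 ω → ∀ {ℓ : ℝ}, 0 < ℓ →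
      gammaBarIdx (omegaSeq (assocSeq ω ℓ)) = gammaBarIdx ω := fun h ℓ hℓ =>
    (gammaBarIdx_congr h.1 (h.isWeightFct_omegaSeq hℓ) (h.comparable_omegaSeq hℓ)).symm
  have hwd : gammaBarIdx τ < gammaIdx σ → ∀ {ℓ j : ℝ}, 0 < ℓ → 0 < j →
      UpperConjWD (omegaSeq (assocSeq σ ℓ)) (omegaSeq (assocSeq τ j)) := fun hlt ℓ j hℓ hj =>
    upperConjWD_of_gammaIdx_pos (hσ.isWeightFct_omegaSeq hℓ) (hτ.isWeightFct_omegaSeq hj)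
      (isLittleO_omegaSeq hσ hτ hlo hℓ hj) (by rw [hγ hσ hℓ]; exact pos_of_gt hlt)
  refine ⟨fun hlt ℓ hℓ ℓ₁ hℓ₁ j hj j₁ hj₁ => ?_,
    fun hpos hττ hlt hσσ _ ℓ hℓ ℓ₁ hℓ₁ j hj j₁ hj₁ => ?_⟩
  · rw [hγ hσ hℓ₁, ← hγ hσ hℓ, hγbar hτ hj₁, ← hγbar hτ hj]
    exact gammaIdx_le_upperConj_add (hσ.isWeightFct_omegaSeq hℓ) (hτ.isWeightFct_omegaSeq hj)
      (hwd hlt hℓ hj)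
  · rw [hγbar hσ hℓ₁, ← hγbar hσ hℓ, hγ hτ hj₁, ← hγ hτ hj]
    refine gammaBarIdx_upperConj_add_le (hσ.isWeightFct_omegaSeq hℓ)
      (hτ.isWeightFct_omegaSeq hj) (hwd hlt hℓ hj) ?_ ?_
    · rwa [hγ hτ hj]
    · rw [hγ hτ hj, hγbar hσ hℓ]
      exact hττ.trans_lt (hlt.trans_le hσσ)
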